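/- For every triangulation T of P one has Σ_{j∈[n+1]} x_j(T) = (n+2)(n+1)/2, and for every internal diagonal δ of P one has Σ_{j∈Bel(δ)} x_j(T) ≥ (bel(δ)+1)·bel(δ)/2. -/

import Mathlib

attribute [local instance] Classical.propDecidable

noncomputable section

namespace Spines

/-- Position of vertex `v ∈ {0,…,n+2}` in the counterclockwise boundary cyclic order:
`0`, then the elements of `D` in increasing order, then `n+2`, then the elements of `U`
in decreasing order. -/
def pos (n : ℕ) (D U : Finset ℕ) (v : ℕ) : ℕ :=
  if v = 0 then 0
  else if v = n + 2 then D.card + 1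
  else if v ∈ D then 1 + (D.filter (fun d => d < v)).card
  else D.card + 2 + (U.filter (fun u => v < u)).card

/-- Cyclic distance from `a` to `v` in counterclockwise direction. -/
def relpos (n : ℕ) (D U : Finset ℕ) (a v : ℕ) : ℕ :=
  (pos n D U v + (n + 3) - pos n D U a) % (n + 3)

/-- `v` lies strictly inside the counterclockwise boundary arc from `a` to `b`. -/
def StrictBetween (n : ℕ) (D U : Finset ℕ) (a b v : ℕ) : Prop :=
  v ≤ n + 2 ∧ 0 < relpos n D U a v ∧ relpos n D U a v < relpos n D U a b

/-- A diagonal, encoded as an ordered pair `(a,b)` with `a < b ≤ n+2`. -/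
def IsDiag (n : ℕ) (δ : ℕ × ℕ) : Prop := δ.1 < δ.2 ∧ δ.2 ≤ n + 2

/-- A boundary edge: the endpoints are adjacent in the cyclic order. -/
def IsBoundaryEdge (n : ℕ) (D U : Finset ℕ) (δ : ℕ × ℕ) : Prop :=
  IsDiag n δ ∧ (relpos n D U δ.1 δ.2 = 1 ∨ relpos n D U δ.2 δ.1 = 1)

/-- An internal diagonal. -/
def IsInternalDiag (n : ℕ) (D U : Finset ℕ) (δ : ℕ × ℕ) : Prop :=
  IsDiag n δ ∧ ¬ IsBoundaryEdge n D U δ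

/-- Two diagonals cross: the four endpoints are pairwise distinct and exactly one
endpoint of the second lies strictly inside each of the two arcs determined by the first. -/
def Cross (n : ℕ) (D U : Finset ℕ) (δ δ' : ℕ × ℕ) : Prop :=
  δ.1 ≠ δ.2 ∧ δ'.1 ≠ δ'.2 ∧ δ.1 ≠ δ'.1 ∧ δ.1 ≠ δ'.2 ∧ δ.2 ≠ δ'.1 ∧ δ.2 ≠ δ'.2 ∧
  ((StrictBetween n D U δ.1 δ.2 δ'.1 ∧ StrictBetween n D U δ.2 δ.1 δ'.2) ∨
   (StrictBetween n D U δ.1 δ.2 δ'.2 ∧ StrictBetween n D U δ.2 δ.1 δ'.1))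

/-- A triangulation: a maximal set of pairwise non-crossing internal diagonals. -/
def IsTriangulation (n : ℕ) (D U : Finset ℕ) (T : Finset (ℕ × ℕ)) : Prop :=
  (∀ δ ∈ T, IsInternalDiag n D U δ) ∧
  (∀ δ ∈ T, ∀ δ' ∈ T, ¬ Cross n D U δ δ') ∧
  (∀ δ, IsInternalDiag n D U δ → δ ∉ T → ∃ δ' ∈ T, Cross n D U δ δ')

/-- `a` and `b` (with `a < b`) are joined by a diagonal of `T` or a boundary edge. -/
def EdgeOf (n : ℕ) (D U : Finset ℕ) (T : Finset (ℕ × ℕ)) (a b : ℕ) : Prop :=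
  (a, b) ∈ T ∨ IsBoundaryEdge n D U (a, b)

/-- `{i,j,k}` with `i<j<k` is a triangle of the triangulation `T`. -/
def IsTriangleOf (n : ℕ) (D U : Finset ℕ) (T : Finset (ℕ × ℕ)) (i j k : ℕ) : Prop :=
  i < j ∧ j < k ∧ k ≤ n + 2 ∧
    EdgeOf n D U T i j ∧ EdgeOf n D U T j k ∧ EdgeOf n D U T i k

/-- `Bel δ`: labels in `[n+1]` strictly inside the ccw arc from `δ.1` to `δ.2`,
together with the endpoints of `δ` lying in `U`. -/
def Bel (n : ℕ) (D U : Finset ℕ) (δ : ℕ × ℕ) : Finset ℕ :=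
  (Finset.Icc 1 (n + 1)).filter
    (fun j => StrictBetween n D U δ.1 δ.2 j ∨ (j ∈ U ∧ (j = δ.1 ∨ j = δ.2)))

def bel (n : ℕ) (D U : Finset ℕ) (δ : ℕ × ℕ) : ℕ := (Bel n D U δ).card

def Abo (n : ℕ) (D U : Finset ℕ) (δ : ℕ × ℕ) : Finset ℕ :=
  Finset.Icc 1 (n + 1) \ Bel n D U δ

/-- The coordinates of the point `x(T)` associated to a triangulation `T`. -/
def xcoord (n : ℕ) (D U : Finset ℕ) (T : Finset (ℕ × ℕ)) (j : ℕ) : ℝ :=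
  if h : ∃ p : ℕ × ℕ, IsTriangleOf n D U T p.1 j p.2 then
    if j ∈ D then
      ((bel n D U (h.choose.1, j) : ℝ) + 1) * ((bel n D U (j, h.choose.2) : ℝ) + 1)
    else
      ((n : ℝ) + 2) -
        (((n : ℝ) + 2) - (bel n D U (h.choose.1, j) : ℝ)) *
          (((n : ℝ) + 2) - (bel n D U (j, h.choose.2) : ℝ))
  else 0

/-- Middle vertex of the triple `{a,b,c}` with `a < b` and `c ∉ {a,b}`. -/
def midOf (a b c : ℕ) : ℕ := if c < a then a else if c < b then c else b

/-- `c` is the third vertex of a triangle of `T` containing the diagonal `δ`. -/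
def TriWith (n : ℕ) (D U : Finset ℕ) (T : Finset (ℕ × ℕ)) (δ : ℕ × ℕ) (c : ℕ) : Prop :=
  if c < δ.1 then IsTriangleOf n D U T c δ.1 δ.2
  else if c < δ.2 then IsTriangleOf n D U T δ.1 c δ.2
  else IsTriangleOf n D U T δ.1 δ.2 c

/-- `s_δ`: middle vertex of the triangle of `T` below `δ` (third vertex strictly
inside the ccw arc from `δ.1` to `δ.2`). -/
def spineSrc (n : ℕ) (D U : Finset ℕ) (T : Finset (ℕ × ℕ)) (δ : ℕ × ℕ) : ℕ :=
  if h : ∃ c, StrictBetween n D U δ.1 δ.2 c ∧ TriWith n D U T δ c then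
    midOf δ.1 δ.2 h.choose
  else 0

/-- `t_δ`: middle vertex of the triangle of `T` above `δ` (third vertex strictly
inside the ccw arc from `δ.2` to `δ.1`). -/
def spineTgt (n : ℕ) (D U : Finset ℕ) (T : Finset (ℕ × ℕ)) (δ : ℕ × ℕ) : ℕ :=
  if h : ∃ c, StrictBetween n D U δ.2 δ.1 c ∧ TriWith n D U T δ c then
    midOf δ.1 δ.2 h.choose
  else 0

/-- `(p,q)` is an arc of the spine of `T`. -/
def SpineArc (n : ℕ) (D U : Finset ℕ) (T : Finset (ℕ × ℕ)) (p q : ℕ) : Prop :=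
  ∃ δ ∈ T, spineSrc n D U T δ = p ∧ spineTgt n D U T δ = q

/-- The finite set of all triangulations of the polygon. -/
def allTri (n : ℕ) (D U : Finset ℕ) : Finset (Finset (ℕ × ℕ)) :=
  ((Finset.range (n + 3) ×ˢ Finset.range (n + 3)).filter
      (fun δ => IsInternalDiag n D U δ)).powerset.filter
    (fun T => IsTriangulation n D U T)

end Spines

namespace Spines

/-! ### Triangulated polygons with vertices `0, …, L` in cyclic order -/

/-- `e` is the edge relation (boundary edges included) of a triangulation of the convex polygon
with vertices `0, …, L` in cyclic order; only `e p q` with `p < q ≤ L` is relevant. -/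
structure IsTriangulated (L : ℕ) (e : ℕ → ℕ → Prop) : Prop where
  adj : ∀ p < L, e p (p + 1)
  closing : e 0 L
  noncrossing : ∀ p r q s, p < r → r < q → q < s → s ≤ L → e p q → e r s → False
  maximal : ∀ p q, p < q → q ≤ L → ¬ e p q →
    ∃ r s, e r s ∧ s ≤ L ∧ ((p < r ∧ r < q ∧ q < s) ∨ (r < p ∧ p < s ∧ s < q))

/-- The triangles of `e` with all vertices between `p` and `q`. -/
def triangles (e : ℕ → ℕ → Prop) (p q : ℕ) : Finset (ℕ × ℕ × ℕ) :=
  (Finset.range (q + 1) ×ˢ Finset.range (q + 1) ×ˢ Finset.range (q + 1)).filter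
    (fun t => p ≤ t.1 ∧ t.1 < t.2.1 ∧ t.2.1 < t.2.2 ∧ e t.1 t.2.1 ∧ e t.2.1 t.2.2 ∧ e t.1 t.2.2)

lemma mem_triangles {e : ℕ → ℕ → Prop} {p q x y z : ℕ} :
    (x, y, z) ∈ triangles e p q ↔
      p ≤ x ∧ x < y ∧ y < z ∧ z ≤ q ∧ e x y ∧ e y z ∧ e x z := by
  simp only [triangles, Finset.mem_filter, Finset.mem_product, Finset.mem_range]
  constructor
  · rintro ⟨⟨h1, h2, h3⟩, h4, h5, h6, h7⟩
    exact ⟨h4, h5, h6, by omega, h7⟩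
  · rintro ⟨h4, h5, h6, h3, h7⟩
    exact ⟨⟨by omega, by omega, by omega⟩, h4, h5, h6, h7⟩

lemma IsTriangulated.exists_apex {L : ℕ} {e : ℕ → ℕ → Prop} (he : IsTriangulated L e)
    {p q : ℕ} (hpq : p + 1 < q) (hq : q ≤ L) (h : e p q) :
    ∃ r, p < r ∧ r < q ∧ e p r ∧ e r q := by
  classical
  let S := (Finset.Ioo p q).filter (fun r => e p r)
  have hS : S.Nonempty :=
    ⟨p + 1, Finset.mem_filter.2 ⟨Finset.mem_Ioo.2 ⟨by omega, hpq⟩, he.adj p (by omega)⟩⟩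
  obtain ⟨h1, h2⟩ := Finset.mem_filter.1 (S.max'_mem hS)
  have hmax : ∀ r, p < r → r < q → e p r → r ≤ S.max' hS := fun r h3 h4 h5 =>
    S.le_max' r (Finset.mem_filter.2 ⟨Finset.mem_Ioo.2 ⟨h3, h4⟩, h5⟩)
  generalize S.max' hS = c at *
  rw [Finset.mem_Ioo] at h1
  refine ⟨c, h1.1, h1.2, h2, ?_⟩
  by_contra hc
  obtain ⟨r, s, hrs, hs, ⟨h3, h4, h5⟩ | ⟨h3, h4, h5⟩⟩ := he.maximal c q h1.2 hq hc
  · exact he.noncrossing p r q s (by omega) h4 h5 hs h hrs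
  · rcases lt_trichotomy r p with h6 | rfl | h6
    · exact he.noncrossing r p s q h6 (by omega) h5 hq hrs h
    · exact absurd (hmax s (by omega) h5 hrs) (by omega)
    · exact he.noncrossing p r c s h6 h3 h4 hs h2 hrs

/-- Discrete Stokes formula for the part of a triangulated polygon cut off by an edge. -/
lemma IsTriangulated.sum_triangles {L : ℕ} {e : ℕ → ℕ → Prop} (he : IsTriangulated L e)
    (ω : ℕ → ℕ → ℝ) {p q : ℕ} (hpq : p < q) (hq : q ≤ L) (h : e p q) :
    ∑ t ∈ triangles e p q, (ω t.1 t.2.1 + ω t.2.1 t.2.2 - ω t.1 t.2.2) =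
      ∑ s ∈ Finset.Ico p q, ω s (s + 1) - ω p q := by
  classical
  induction hd : q - p using Nat.strong_induction_on generalizing p q with
  | _ d ih =>
    subst hd
    by_cases h1 : q = p + 1
    · subst h1
      have : triangles e p (p + 1) = ∅ := by
        ext ⟨x, y, z⟩
        rw [mem_triangles]
        simp only [Finset.notMem_empty, iff_false]
        omega
      simp [this]
    · obtain ⟨r, hr1, hr2, h2, h3⟩ := he.exists_apex (by omega) hq h
      have hdec : triangles e p q =
          insert (p, r, q) (triangles e p r ∪ triangles e r q) := by
        ext ⟨x, y, z⟩
        simp only [Finset.mem_insert, Finset.mem_union, mem_triangles, Prod.mk.injEq]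
        constructor
        · rintro ⟨h4, h5, h6, h7, h8, h9, h10⟩
          by_cases hz : z ≤ r
          · right; left; exact ⟨h4, h5, h6, hz, h8, h9, h10⟩
          by_cases hx : r ≤ x
          · right; right; exact ⟨hx, h5, h6, h7, h8, h9, h10⟩
          left
          have hxp : x = p := by
            by_contra hne
            exact he.noncrossing p x r z (by omega) (by omega) (by omega) (by omega) h2 h10
          have hzq : z = q := by
            by_contra hne
            exact he.noncrossing x r z q (by omega) (by omega) (by omega) (by omega) h10 h3
          refine ⟨hxp, ?_, hzq⟩
          rcases lt_trichotomy y r with h11 | h11 | h11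
          · exact (he.noncrossing p y r z (by omega) (by omega) (by omega) (by omega) h2 h9).elim
          · exact h11
          · exact (he.noncrossing x r y q (by omega) (by omega) (by omega) (by omega) h8 h3).elim
        · rintro (⟨rfl, rfl, rfl⟩ | ⟨h4, h5, h6, h7, h8⟩ | ⟨h4, h5, h6, h7, h8⟩)
          · exact ⟨le_rfl, hr1, hr2, le_rfl, h2, h3, h⟩
          · exact ⟨h4, h5, h6, by omega, h8⟩
          · exact ⟨by omega, h5, h6, h7, h8⟩
      have hdisj : Disjoint (triangles e p r) (triangles e r q) := by
        rw [Finset.disjoint_left]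
        rintro ⟨x, y, z⟩ h4 h5
        rw [mem_triangles] at h4 h5
        omega
      have hnot : (p, r, q) ∉ triangles e p r ∪ triangles e r q := by
        simp only [Finset.mem_union, mem_triangles]
        omega
      rw [hdec, Finset.sum_insert hnot, Finset.sum_union hdisj,
        ih (r - p) (by omega) hr1 (by omega) h2 rfl, ih (q - r) (by omega) hr2 hq h3 rfl,
        ← Finset.sum_Ico_consecutive _ hr1.le hr2.le]
      ring

lemma IsTriangulated.card_triangles {L : ℕ} {e : ℕ → ℕ → Prop} (he : IsTriangulated L e)
    (hL : 0 < L) : (triangles e 0 L).card + 1 = L := by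
  have h := he.sum_triangles (fun _ _ => 1) hL le_rfl he.closing
  simp only [add_sub_cancel_right, Finset.sum_const, nsmul_eq_mul, mul_one, Nat.card_Ico,
    tsub_zero] at h
  rw [eq_sub_iff_add_eq] at h
  exact_mod_cast h

/-! ### Positions on the boundary -/

lemma mem_Icc_of_mem_D {n : ℕ} {D U : Finset ℕ} (hUD : D ∪ U = Finset.Icc 1 (n + 1)) {v : ℕ}
    (hv : v ∈ D) : 1 ≤ v ∧ v ≤ n + 1 :=
  Finset.mem_Icc.1 (hUD ▸ Finset.mem_union_left U hv)

lemma mem_Icc_of_mem_U {n : ℕ} {D U : Finset ℕ} (hUD : D ∪ U = Finset.Icc 1 (n + 1)) {v : ℕ}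
    (hv : v ∈ U) : 1 ≤ v ∧ v ≤ n + 1 :=
  Finset.mem_Icc.1 (hUD ▸ Finset.mem_union_right D hv)

lemma mem_D_iff {n : ℕ} {D U : Finset ℕ} (hUD : D ∪ U = Finset.Icc 1 (n + 1))
    (hdisj : Disjoint D U) {v : ℕ} : v ∈ D ↔ 1 ≤ v ∧ v ≤ n + 1 ∧ v ∉ U := by
  constructor
  · intro h
    have := mem_Icc_of_mem_D hUD h
    exact ⟨this.1, this.2, Finset.disjoint_left.1 hdisj h⟩
  · rintro ⟨h1, h2, h3⟩
    have : v ∈ D ∪ U := hUD ▸ Finset.mem_Icc.2 ⟨h1, h2⟩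
    exact (Finset.mem_union.1 this).resolve_right h3

lemma card_D_add_card_U {n : ℕ} {D U : Finset ℕ} (hUD : D ∪ U = Finset.Icc 1 (n + 1))
    (hdisj : Disjoint D U) : D.card + U.card = n + 1 := by
  rw [← Finset.card_union_of_disjoint hdisj, hUD]
  simp

lemma pos_zero (n : ℕ) (D U : Finset ℕ) : pos n D U 0 = 0 := by simp [pos]

lemma pos_last (n : ℕ) (D U : Finset ℕ) : pos n D U (n + 2) = D.card + 1 := by simp [pos]

lemma pos_of_mem_D {n : ℕ} {D U : Finset ℕ} (hUD : D ∪ U = Finset.Icc 1 (n + 1)) {v : ℕ}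
    (hv : v ∈ D) : pos n D U v = 1 + (D.filter (fun d => d < v)).card := by
  have := mem_Icc_of_mem_D hUD hv
  unfold pos
  rw [if_neg (by omega), if_neg (by omega), if_pos hv]

lemma pos_of_mem_U {n : ℕ} {D U : Finset ℕ} (hUD : D ∪ U = Finset.Icc 1 (n + 1))
    (hdisj : Disjoint D U) {v : ℕ} (hv : v ∈ U) :
    pos n D U v = D.card + 2 + (U.filter (fun u => v < u)).card := by
  have := mem_Icc_of_mem_U hUD hv
  unfold pos
  rw [if_neg (by omega), if_neg (by omega), if_neg (Finset.disjoint_right.1 hdisj hv)]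

lemma pos_le_card_of_mem_D {n : ℕ} {D U : Finset ℕ} (hUD : D ∪ U = Finset.Icc 1 (n + 1)) {v : ℕ}
    (hv : v ∈ D) : pos n D U v ≤ D.card := by
  rw [pos_of_mem_D hUD hv]
  have : (D.filter (fun d => d < v)).card < D.card :=
    Finset.card_lt_card (Finset.filter_ssubset.2 ⟨v, hv, lt_irrefl v⟩)
  omega

lemma pos_lt_pos {n : ℕ} {D U : Finset ℕ} (hUD : D ∪ U = Finset.Icc 1 (n + 1))
    (hdisj : Disjoint D U) {x y : ℕ} (hxy : x < y) (hy : y ≤ n + 2) (hx : x ∉ U) :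
    pos n D U x < pos n D U y := by
  by_cases hy' : y = n + 2
  · subst hy'
    rw [pos_last]
    by_cases hx0 : x = 0
    · subst hx0; rw [pos_zero]; omega
    · have := pos_le_card_of_mem_D hUD ((mem_D_iff hUD hdisj).2 ⟨by omega, by omega, hx⟩)
      omega
  by_cases hyU : y ∈ U
  · rw [pos_of_mem_U hUD hdisj hyU]
    by_cases hx0 : x = 0
    · subst hx0; rw [pos_zero]; omega
    · have := pos_le_card_of_mem_D hUD ((mem_D_iff hUD hdisj).2 ⟨by omega, by omega, hx⟩)
      omega
  · have hyD : y ∈ D := (mem_D_iff hUD hdisj).2 ⟨by omega, by omega, hyU⟩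
    by_cases hx0 : x = 0
    · subst hx0; rw [pos_zero, pos_of_mem_D hUD hyD]; omega
    · have hxD : x ∈ D := (mem_D_iff hUD hdisj).2 ⟨by omega, by omega, hx⟩
      rw [pos_of_mem_D hUD hyD, pos_of_mem_D hUD hxD]
      refine Nat.add_lt_add_left (Finset.card_lt_card ?_) 1
      rw [Finset.ssubset_iff_of_subset]
      · exact ⟨x, by simp [hxD, hxy]⟩
      · intro d hd
        rw [Finset.mem_filter] at hd ⊢
        exact ⟨hd.1, hd.2.trans hxy⟩

lemma pos_gt_pos {n : ℕ} {D U : Finset ℕ} (hUD : D ∪ U = Finset.Icc 1 (n + 1))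
    (hdisj : Disjoint D U) {x y : ℕ} (hxy : x < y) (hy : y ≤ n + 2) (hx : x ∈ U) :
    pos n D U y < pos n D U x := by
  rw [pos_of_mem_U hUD hdisj hx]
  have hx1 := mem_Icc_of_mem_U hUD hx
  by_cases hy' : y = n + 2
  · subst hy'
    rw [pos_last]
    omega
  by_cases hyU : y ∈ U
  · rw [pos_of_mem_U hUD hdisj hyU]
    refine Nat.add_lt_add_left (Finset.card_lt_card ?_) _
    rw [Finset.ssubset_iff_of_subset]
    · exact ⟨y, by simp [hyU, hxy]⟩
    · intro d hd
      rw [Finset.mem_filter] at hd ⊢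
      exact ⟨hd.1, hxy.trans hd.2⟩
  · have := pos_le_card_of_mem_D hUD ((mem_D_iff hUD hdisj).2 ⟨by omega, by omega, hyU⟩)
    omega

lemma pos_lt {n : ℕ} {D U : Finset ℕ} (hUD : D ∪ U = Finset.Icc 1 (n + 1))
    (hdisj : Disjoint D U) {v : ℕ} (hv : v ≤ n + 2) : pos n D U v < n + 3 := by
  have hc := card_D_add_card_U hUD hdisj
  by_cases hvU : v ∈ U
  · rw [pos_of_mem_U hUD hdisj hvU]
    have : (U.filter (fun u => v < u)).card < U.card :=
      Finset.card_lt_card (Finset.filter_ssubset.2 ⟨v, hvU, lt_irrefl v⟩)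
    omega
  · by_cases h : v = n + 2
    · subst h; rw [pos_last]; omega
    · have := pos_lt_pos hUD hdisj (show v < n + 2 by omega) le_rfl hvU
      rw [pos_last] at this
      omega

lemma pos_injOn {n : ℕ} {D U : Finset ℕ} (hUD : D ∪ U = Finset.Icc 1 (n + 1))
    (hdisj : Disjoint D U) {x y : ℕ} (hx : x ≤ n + 2) (hy : y ≤ n + 2)
    (h : pos n D U x = pos n D U y) : x = y := by
  rcases lt_trichotomy x y with h1 | h1 | h1
  · by_cases hU : x ∈ U
    · have := pos_gt_pos hUD hdisj h1 hy hU; omega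
    · have := pos_lt_pos hUD hdisj h1 hy hU; omega
  · exact h1
  · by_cases hU : y ∈ U
    · have := pos_gt_pos hUD hdisj h1 hx hU; omega
    · have := pos_lt_pos hUD hdisj h1 hx hU; omega

lemma exists_label {n : ℕ} {D U : Finset ℕ} (hUD : D ∪ U = Finset.Icc 1 (n + 1))
    (hdisj : Disjoint D U) : ∃ ρ : ℕ → ℕ, ∀ p ≤ n + 2, ρ p ≤ n + 2 ∧ pos n D U (ρ p) = p := by
  have hsurj := Finset.surjOn_of_injOn_of_card_le (s := Finset.range (n + 3))
    (t := Finset.range (n + 3)) (pos n D U)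
    (fun x hx => by
      simp only [Finset.coe_range, Set.mem_Iio] at hx ⊢
      exact pos_lt hUD hdisj (by omega))
    (fun x hx y hy h => by
      simp only [Finset.coe_range, Set.mem_Iio] at hx hy
      exact pos_injOn hUD hdisj (by omega) (by omega) h) le_rfl
  have : ∀ p, ∃ v, p ≤ n + 2 → v ≤ n + 2 ∧ pos n D U v = p := by
    intro p
    by_cases hp : p ≤ n + 2
    · obtain ⟨v, hv, hvp⟩ := hsurj (show p ∈ (Finset.range (n + 3) : Set ℕ) by
        simp only [Finset.coe_range, Set.mem_Iio]; omega)
      simp only [Finset.coe_range, Set.mem_Iio] at hv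
      exact ⟨v, fun _ => ⟨by omega, hvp⟩⟩
    · exact ⟨0, fun h => absurd h hp⟩
  choose ρ hρ using this
  exact ⟨ρ, hρ⟩

lemma relpos_eq {n : ℕ} {D U : Finset ℕ} (hUD : D ∪ U = Finset.Icc 1 (n + 1))
    (hdisj : Disjoint D U) {a v : ℕ} (ha : a ≤ n + 2) (hv : v ≤ n + 2) :
    (pos n D U a ≤ pos n D U v ∧ relpos n D U a v + pos n D U a = pos n D U v) ∨
    (pos n D U v < pos n D U a ∧ relpos n D U a v + pos n D U a = pos n D U v + (n + 3)) := by
  have h1 := pos_lt hUD hdisj ha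
  have h2 := pos_lt hUD hdisj hv
  unfold relpos
  rcases le_or_gt (pos n D U a) (pos n D U v) with h | h
  · left
    refine ⟨h, ?_⟩
    rw [show pos n D U v + (n + 3) - pos n D U a = (pos n D U v - pos n D U a) + (n + 3) by omega,
      Nat.add_mod_right, Nat.mod_eq_of_lt (by omega)]
    omega
  · right
    refine ⟨h, ?_⟩
    rw [Nat.mod_eq_of_lt (by omega)]
    omega

lemma strictBetween_iff {n : ℕ} {D U : Finset ℕ} (hUD : D ∪ U = Finset.Icc 1 (n + 1))
    (hdisj : Disjoint D U) {a b v : ℕ} (ha : a ≤ n + 2) (hb : b ≤ n + 2) (hv : v ≤ n + 2) :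
    StrictBetween n D U a b v ↔
      (pos n D U a < pos n D U v ∧ pos n D U v < pos n D U b) ∨
      (pos n D U v < pos n D U b ∧ pos n D U b < pos n D U a) ∨
      (pos n D U b < pos n D U a ∧ pos n D U a < pos n D U v) := by
  unfold StrictBetween
  have h1 := pos_lt hUD hdisj ha
  have h2 := pos_lt hUD hdisj hv
  have h3 := pos_lt hUD hdisj hb
  have h4 := relpos_eq hUD hdisj ha hv
  have h5 := relpos_eq hUD hdisj ha hb
  omega

lemma relpos_eq_one_iff {n : ℕ} {D U : Finset ℕ} (hUD : D ∪ U = Finset.Icc 1 (n + 1))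
    (hdisj : Disjoint D U) {a b : ℕ} (ha : a ≤ n + 2) (hb : b ≤ n + 2) :
    relpos n D U a b = 1 ↔
      pos n D U b = pos n D U a + 1 ∨ (pos n D U a = n + 2 ∧ pos n D U b = 0) := by
  have h1 := pos_lt hUD hdisj ha
  have h3 := pos_lt hUD hdisj hb
  have h5 := relpos_eq hUD hdisj ha hb
  omega

lemma mem_Bel {n : ℕ} {D U : Finset ℕ} (hUD : D ∪ U = Finset.Icc 1 (n + 1))
    (hdisj : Disjoint D U) {a b v : ℕ} (hab : a < b) (hb : b ≤ n + 2) :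
    v ∈ Bel n D U (a, b) ↔ (1 ≤ v ∧ v ≤ n + 1) ∧
      ((v ∉ U ∧ (a ∈ U ∨ a < v) ∧ (b ∈ U ∨ v < b)) ∨
        (v ∈ U ∧ ((a ∈ U ∧ v ≤ a) ∨ (b ∈ U ∧ b ≤ v)))) := by
  unfold Bel
  rw [Finset.mem_filter, Finset.mem_Icc]
  refine and_congr_right fun hv => ?_
  rw [strictBetween_iff hUD hdisj (by omega) hb (by omega)]
  dsimp only
  have key : ∀ x y, x < y → y ≤ n + 2 → (x ∉ U ∧ pos n D U x < pos n D U y) ∨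
      (x ∈ U ∧ pos n D U y < pos n D U x) := fun x y hxy hy => by
    by_cases hx : x ∈ U
    · exact Or.inr ⟨hx, pos_gt_pos hUD hdisj hxy hy hx⟩
    · exact Or.inl ⟨hx, pos_lt_pos hUD hdisj hxy hy hx⟩
  have hbn : b ∉ U → v ∉ U → b ≤ v → pos n D U b < n + 3 := fun _ _ _ => pos_lt hUD hdisj hb
  have kab := key a b hab hb
  have kb : b ∈ U → pos n D U (n + 2) < pos n D U b := fun h => by
    have := mem_Icc_of_mem_U hUD h
    exact pos_gt_pos hUD hdisj (by omega) le_rfl h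
  have kbn : b ∉ U → pos n D U b ≤ pos n D U (n + 2) := fun h => by
    rcases hb.lt_or_eq with h' | h'
    · exact (pos_lt_pos hUD hdisj h' le_rfl h).le
    · rw [h']
  have kv := key v (n + 2) (by omega) le_rfl
  have kan := key a (n + 2) (by omega) le_rfl
  rcases lt_trichotomy v a with h | rfl | h
  · have k1 := key v a h (by omega)
    have k2 := key v b (by omega) hb
    have : ¬ (v = a) := by omega
    have : ¬ (v = b) := by omega
    have : ¬ (a < v) := by omega
    have : ¬ (b ≤ v) := by omega
    have : v ≤ a := by omega
    have : v < b := by omega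
    by_cases hvU : v ∈ U <;> by_cases haU : a ∈ U <;> by_cases hbU : b ∈ U <;>
      simp_all <;> omega
  · by_cases hvU : v ∈ U <;> by_cases hbU : b ∈ U <;> simp_all <;> omega
  · rcases lt_trichotomy v b with h' | rfl | h'
    · have k1 := key a v h (by omega)
      have k2 := key v b h' hb
      have : ¬ (v = a) := by omega
      have : ¬ (v = b) := by omega
      have : ¬ (v ≤ a) := by omega
      have : ¬ (b ≤ v) := by omega
      by_cases hvU : v ∈ U <;> by_cases haU : a ∈ U <;> by_cases hbU : b ∈ U <;>
        simp_all <;> omega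
    · by_cases hvU : v ∈ U <;> by_cases haU : a ∈ U <;> simp_all <;> omega
    · have k1 := key a v h (by omega)
      have k2 := key b v h' (by omega)
      have : ¬ (v = a) := by omega
      have : ¬ (v = b) := by omega
      have : ¬ (v ≤ a) := by omega
      have : ¬ (v < b) := by omega
      have : b ≤ v := by omega
      by_cases hvU : v ∈ U <;> by_cases haU : a ∈ U <;> by_cases hbU : b ∈ U <;>
        simp_all <;> omega

/-! ### Triangulations in terms of positions -/

lemma not_mem_U_of_pos_lt {n : ℕ} {D U : Finset ℕ} (hUD : D ∪ U = Finset.Icc 1 (n + 1))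
    (hdisj : Disjoint D U) {x y : ℕ} (hxy : x < y) (hy : y ≤ n + 2)
    (h : pos n D U x < pos n D U y) : x ∉ U := fun hx =>
  absurd (pos_gt_pos hUD hdisj hxy hy hx) (by omega)

lemma mem_U_of_pos_gt {n : ℕ} {D U : Finset ℕ} (hUD : D ∪ U = Finset.Icc 1 (n + 1))
    (hdisj : Disjoint D U) {x y : ℕ} (hxy : x < y) (hy : y ≤ n + 2)
    (h : pos n D U y < pos n D U x) : x ∈ U := by
  by_contra hx
  exact absurd (pos_lt_pos hUD hdisj hxy hy hx) (by omega)

lemma cross_iff {n : ℕ} {D U : Finset ℕ} (hUD : D ∪ U = Finset.Icc 1 (n + 1))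
    (hdisj : Disjoint D U) {a b c d : ℕ} (ha : a ≤ n + 2) (hb : b ≤ n + 2) (hc : c ≤ n + 2)
    (hd : d ≤ n + 2) :
    Cross n D U (a, b) (c, d) ↔
      (pos n D U a < pos n D U c ∧ pos n D U c < pos n D U b ∧
        (pos n D U d < pos n D U a ∨ pos n D U b < pos n D U d)) ∨
      (pos n D U b < pos n D U c ∧ pos n D U c < pos n D U a ∧
        (pos n D U d < pos n D U b ∨ pos n D U a < pos n D U d)) ∨
      (pos n D U a < pos n D U d ∧ pos n D U d < pos n D U b ∧
        (pos n D U c < pos n D U a ∨ pos n D U b < pos n D U c)) ∨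
      (pos n D U b < pos n D U d ∧ pos n D U d < pos n D U a ∧
        (pos n D U c < pos n D U b ∨ pos n D U a < pos n D U c)) := by
  have hne : ∀ {x y : ℕ}, x ≤ n + 2 → y ≤ n + 2 → (x ≠ y ↔ pos n D U x ≠ pos n D U y) :=
    fun hx hy => ⟨fun h h' => h (pos_injOn hUD hdisj hx hy h'), fun h h' => h (by rw [h'])⟩
  unfold Cross
  dsimp only
  rw [hne ha hb, hne hc hd, hne ha hc, hne ha hd, hne hb hc, hne hb hd,
    strictBetween_iff hUD hdisj ha hb hc, strictBetween_iff hUD hdisj ha hb hd,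
    strictBetween_iff hUD hdisj hb ha hc, strictBetween_iff hUD hdisj hb ha hd]
  omega

lemma isBoundaryEdge_iff {n : ℕ} {D U : Finset ℕ} (hUD : D ∪ U = Finset.Icc 1 (n + 1))
    (hdisj : Disjoint D U) {a b : ℕ} (hab : a < b) (hb : b ≤ n + 2) :
    IsBoundaryEdge n D U (a, b) ↔
      pos n D U b = pos n D U a + 1 ∨ (pos n D U a = n + 2 ∧ pos n D U b = 0) ∨
      pos n D U a = pos n D U b + 1 ∨ (pos n D U b = n + 2 ∧ pos n D U a = 0) := by
  unfold IsBoundaryEdge IsDiag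
  dsimp only
  rw [relpos_eq_one_iff hUD hdisj (by omega) hb, relpos_eq_one_iff hUD hdisj hb (by omega)]
  omega

lemma EdgeOf.isDiag {n : ℕ} {D U : Finset ℕ} {T : Finset (ℕ × ℕ)}
    (hT : IsTriangulation n D U T) {a b : ℕ} (h : EdgeOf n D U T a b) : a < b ∧ b ≤ n + 2 := by
  rcases h with h | h
  · exact (hT.1 _ h).1
  · exact h.1

lemma EdgeOf.not_cross {n : ℕ} {D U : Finset ℕ} (hUD : D ∪ U = Finset.Icc 1 (n + 1))
    (hdisj : Disjoint D U) {T : Finset (ℕ × ℕ)} (hT : IsTriangulation n D U T) {a b c d : ℕ}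
    (h : EdgeOf n D U T a b) (h' : EdgeOf n D U T c d) : ¬ Cross n D U (a, b) (c, d) := by
  obtain ⟨hab, hb⟩ := h.isDiag hT
  obtain ⟨hcd, hd⟩ := h'.isDiag hT
  have ha' := pos_lt hUD hdisj (show a ≤ n + 2 by omega)
  have hb' := pos_lt hUD hdisj hb
  have hc' := pos_lt hUD hdisj (show c ≤ n + 2 by omega)
  have hd' := pos_lt hUD hdisj hd
  rcases h with h | h
  · rcases h' with h' | h'
    · exact hT.2.1 _ h _ h'
    · rw [isBoundaryEdge_iff hUD hdisj hcd hd] at h'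
      rw [cross_iff hUD hdisj (by omega) hb (by omega) hd]
      omega
  · rw [isBoundaryEdge_iff hUD hdisj hab hb] at h
    rw [cross_iff hUD hdisj (by omega) hb (by omega) hd]
    omega

/-- Two triangles of a triangulation with the same middle vertex coincide. -/
lemma IsTriangleOf.unique {n : ℕ} {D U : Finset ℕ} (hUD : D ∪ U = Finset.Icc 1 (n + 1))
    (hdisj : Disjoint D U) {T : Finset (ℕ × ℕ)} (hT : IsTriangulation n D U T)
    {i j k i' k' : ℕ} (h : IsTriangleOf n D U T i j k) (h' : IsTriangleOf n D U T i' j k') :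
    i = i' ∧ k = k' := by
  obtain ⟨hij, hjk, hk, e1, e2, e3⟩ := h
  obtain ⟨hij', hjk', hk', e1', e2', e3'⟩ := h'
  have c1 := EdgeOf.not_cross hUD hdisj hT e3 e1'
  have c2 := EdgeOf.not_cross hUD hdisj hT e3 e2'
  have c3 := EdgeOf.not_cross hUD hdisj hT e3' e1
  have c4 := EdgeOf.not_cross hUD hdisj hT e3' e2
  rw [cross_iff hUD hdisj (by omega) (by omega) (by omega) (by omega)] at c1 c2 c3 c4
  have key : ∀ x y, x < y → y ≤ n + 2 → (x ∉ U ∧ pos n D U x < pos n D U y) ∨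
      (x ∈ U ∧ pos n D U y < pos n D U x) := fun x y hxy hy => by
    by_cases hx : x ∈ U
    · exact Or.inr ⟨hx, pos_gt_pos hUD hdisj hxy hy hx⟩
    · exact Or.inl ⟨hx, pos_lt_pos hUD hdisj hxy hy hx⟩
  have k1 := key i j hij (by omega)
  have k2 := key j k hjk hk
  have k3 := key i k (by omega) hk
  have k4 := key i' j hij' (by omega)
  have k5 := key j k' hjk' hk'
  have k6 := key i' k' (by omega) hk'
  have k7 := key i k' (by omega) hk'
  have k8 := key i' k (by omega) hk
  constructor
  · refine pos_injOn hUD hdisj (by omega) (by omega) ?_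
    clear c2 c4 hij hjk hk hij' hjk' hk' e1 e2 e3 e1' e2' e3' key
    by_cases hi : i ∈ U <;> by_cases hi' : i' ∈ U <;> by_cases hj : j ∈ U <;>
      simp only [hi, hi', hj, not_true_eq_false, not_false_eq_true, true_and, false_and, or_false,
        false_or] at k1 k2 k3 k4 k5 k6 k7 k8 <;> omega
  · refine pos_injOn hUD hdisj (by omega) (by omega) ?_
    clear c1 c3 hij hjk hk hij' hjk' hk' e1 e2 e3 e1' e2' e3' key
    by_cases hi : i ∈ U <;> by_cases hi' : i' ∈ U <;> by_cases hj : j ∈ U <;>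
      simp only [hi, hi', hj, not_true_eq_false, not_false_eq_true, true_and, false_and, or_false,
        false_or] at k1 k2 k3 k4 k5 k6 k7 k8 <;> omega

/-- The edges of a triangulation, read in terms of positions. -/
def posEdge (n : ℕ) (D U : Finset ℕ) (T : Finset (ℕ × ℕ)) (ρ : ℕ → ℕ) (p q : ℕ) : Prop :=
  EdgeOf n D U T (min (ρ p) (ρ q)) (max (ρ p) (ρ q))

lemma isTriangulated_posEdge {n : ℕ} {D U : Finset ℕ} (hUD : D ∪ U = Finset.Icc 1 (n + 1))
    (hdisj : Disjoint D U) {T : Finset (ℕ × ℕ)} (hT : IsTriangulation n D U T) {ρ : ℕ → ℕ}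
    (hρ : ∀ p ≤ n + 2, ρ p ≤ n + 2 ∧ pos n D U (ρ p) = p) :
    IsTriangulated (n + 2) (posEdge n D U T ρ) := by
  have hne : ∀ p q, p < q → q ≤ n + 2 → ρ p ≠ ρ q := fun p q hpq hq h => by
    have h1 := (hρ p (by omega)).2
    rw [h, (hρ q hq).2] at h1
    omega
  refine ⟨fun p hp => ?_, ?_, fun p r q s h1 h2 h3 h4 h5 h6 => ?_, fun p q hpq hq h => ?_⟩
  · have h0 := hne p (p + 1) (by omega) (by omega)
    have h1 := hρ p (by omega)
    have h2 := hρ (p + 1) (by omega)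
    right
    rw [isBoundaryEdge_iff hUD hdisj (by omega) (by omega)]
    rcases lt_or_gt_of_ne h0 with h | h
    · rw [min_eq_left h.le, max_eq_right h.le]; omega
    · rw [min_eq_right h.le, max_eq_left h.le]; omega
  · have h0 := hne 0 (n + 2) (by omega) (by omega)
    have h1 := hρ 0 (by omega)
    have h2 := hρ (n + 2) (by omega)
    right
    rw [isBoundaryEdge_iff hUD hdisj (by omega) (by omega)]
    rcases lt_or_gt_of_ne h0 with h | h
    · rw [min_eq_left h.le, max_eq_right h.le]; omega
    · rw [min_eq_right h.le, max_eq_left h.le]; omega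
  · have hp := hρ p (by omega)
    have hq := hρ q (by omega)
    have hr := hρ r (by omega)
    have hs := hρ s (by omega)
    refine EdgeOf.not_cross hUD hdisj hT h5 h6 ?_
    rw [cross_iff hUD hdisj (by omega) (by omega) (by omega) (by omega)]
    rcases le_total (ρ p) (ρ q) with h7 | h7 <;> rcases le_total (ρ r) (ρ s) with h8 | h8 <;>
      simp only [min_eq_left, max_eq_right, min_eq_right, max_eq_left, h7, h8] <;> omega
  · have h0 := hne p q hpq hq
    have hp := hρ p (by omega)
    have hq' := hρ q (by omega)
    unfold posEdge EdgeOf at h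
    rw [not_or] at h
    obtain ⟨⟨c, d⟩, hcd, hX⟩ := hT.2.2 _ ⟨⟨by dsimp only; omega, by dsimp only; omega⟩, h.2⟩ h.1
    have hcd1 : c < d ∧ d ≤ n + 2 := (hT.1 _ hcd).1
    rw [cross_iff hUD hdisj (by omega) (by omega) (by omega) (by omega)] at hX
    have hc := pos_lt hUD hdisj (show c ≤ n + 2 by omega)
    have hd := pos_lt hUD hdisj (show d ≤ n + 2 by omega)
    have hρpos : ∀ v ≤ n + 2, ρ (pos n D U v) = v := fun v hv => by
      have := hρ (pos n D U v) (by have := pos_lt hUD hdisj hv; omega)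
      exact pos_injOn hUD hdisj this.1 hv this.2
    have e1 : posEdge n D U T ρ (pos n D U c) (pos n D U d) := by
      unfold posEdge
      rw [hρpos c (by omega), hρpos d (by omega), min_eq_left hcd1.1.le, max_eq_right hcd1.1.le]
      exact Or.inl hcd
    have e2 : posEdge n D U T ρ (pos n D U d) (pos n D U c) := by
      unfold posEdge
      rw [hρpos c (by omega), hρpos d (by omega), min_eq_right hcd1.1.le, max_eq_left hcd1.1.le]
      exact Or.inl hcd
    rcases lt_or_ge (pos n D U c) (pos n D U d) with h8 | h8
    · refine ⟨_, _, e1, by omega, ?_⟩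
      rcases le_total (ρ p) (ρ q) with h7 | h7 <;>
        simp only [min_eq_left, max_eq_right, min_eq_right, max_eq_left, h7] at hX <;> omega
    · refine ⟨_, _, e2, by omega, ?_⟩
      rcases le_total (ρ p) (ρ q) with h7 | h7 <;>
        simp only [min_eq_left, max_eq_right, min_eq_right, max_eq_left, h7] at hX <;> omega

/-- The positions, in increasing order, of the vertices `i < j < k`. -/
def sortedPos (n : ℕ) (D U : Finset ℕ) (i j k : ℕ) : ℕ × ℕ × ℕ :=
  if i ∈ U then
    if j ∈ U then (pos n D U k, pos n D U j, pos n D U i)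
    else (pos n D U j, pos n D U k, pos n D U i)
  else
    if j ∈ U then (pos n D U i, pos n D U k, pos n D U j)
    else (pos n D U i, pos n D U j, pos n D U k)

/-- The antisymmetric extension of a function on pairs `x < y`. -/
def antisymm (ψ : ℕ → ℕ → ℝ) (x y : ℕ) : ℝ := if x < y then ψ x y else -ψ y x

lemma antisymm_of_lt (ψ : ℕ → ℕ → ℝ) {x y : ℕ} (h : x < y) : antisymm ψ x y = ψ x y := if_pos h

lemma antisymm_of_gt (ψ : ℕ → ℕ → ℝ) {x y : ℕ} (h : y < x) : antisymm ψ x y = -ψ y x :=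
  if_neg h.le.not_gt

lemma exists_isTriangleOf_of_mem_triangles {n : ℕ} {D U : Finset ℕ}
    (hUD : D ∪ U = Finset.Icc 1 (n + 1)) (hdisj : Disjoint D U) {T : Finset (ℕ × ℕ)} {ρ : ℕ → ℕ}
    (hρ : ∀ p ≤ n + 2, ρ p ≤ n + 2 ∧ pos n D U (ρ p) = p) {t : ℕ × ℕ × ℕ}
    (ht : t ∈ triangles (posEdge n D U T ρ) 0 (n + 2)) :
    ∃ i j k, IsTriangleOf n D U T i j k ∧ t = sortedPos n D U i j k := by
  obtain ⟨p, r, q⟩ := t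
  obtain ⟨-, hpr, hrq, hq, e1, e2, e3⟩ := mem_triangles.1 ht
  obtain ⟨hx, hxp⟩ := hρ p (by omega)
  obtain ⟨hy, hyr⟩ := hρ r (by omega)
  obtain ⟨hz, hzq⟩ := hρ q hq
  unfold posEdge at e1 e2 e3
  generalize ρ p = x at *
  generalize ρ r = y at *
  generalize ρ q = z at *
  subst hxp hyr hzq
  have hxy : x ≠ y := by rintro rfl; omega
  have hyz : y ≠ z := by rintro rfl; omega
  have hxz : x ≠ z := by rintro rfl; omega
  have up := @not_mem_U_of_pos_lt n D U hUD hdisj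
  have dn := @mem_U_of_pos_gt n D U hUD hdisj
  rcases lt_or_gt_of_ne hxy with h1 | h1 <;> rcases lt_or_gt_of_ne hyz with h2 | h2 <;>
    rcases lt_or_gt_of_ne hxz with h3 | h3 <;>
    simp only [min_eq_left h1.le, max_eq_right h1.le, min_eq_right h1.le, max_eq_left h1.le,
      min_eq_left h2.le, max_eq_right h2.le, min_eq_right h2.le, max_eq_left h2.le,
      min_eq_left h3.le, max_eq_right h3.le, min_eq_right h3.le, max_eq_left h3.le] at e1 e2 e3
  · refine ⟨x, y, z, ⟨h1, h2, hz, e1, e2, e3⟩, ?_⟩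
    rw [sortedPos, if_neg (up h1 hy hpr), if_neg (up h2 hz hrq)]
  · omega
  · refine ⟨x, z, y, ⟨h3, h2, hy, e3, e2, e1⟩, ?_⟩
    rw [sortedPos, if_neg (up h1 hy hpr), if_pos (dn h2 hy hrq)]
  · refine ⟨z, x, y, ⟨h3, h1, hy, e3, e1, e2⟩, ?_⟩
    rw [sortedPos, if_pos (dn h2 hy hrq), if_neg (up h1 hy hpr)]
  · exact absurd (dn h1 hx hpr) (up h2 hz hrq)
  · exact absurd (dn h1 hx hpr) (up h2 hz hrq)
  · omega
  · refine ⟨z, y, x, ⟨h2, h1, hx, e2, e1, e3⟩, ?_⟩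
    rw [sortedPos, if_pos (dn h3 hx (hpr.trans hrq)), if_pos (dn h1 hx hpr)]

/-- Every label is the middle vertex of a triangle, and the signed sum over all triangles of the
coboundary of a function `ψ` on diagonals only depends on the boundary edges. -/
lemma exists_triangles_sum_eq {n : ℕ} {D U : Finset ℕ}
    (hUD : D ∪ U = Finset.Icc 1 (n + 1)) (hdisj : Disjoint D U) {T : Finset (ℕ × ℕ)}
    (hT : IsTriangulation n D U T) {ρ : ℕ → ℕ}
    (hρ : ∀ p ≤ n + 2, ρ p ≤ n + 2 ∧ pos n D U (ρ p) = p) :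
    ∃ I K : ℕ → ℕ, (∀ j ∈ Finset.Icc 1 (n + 1), IsTriangleOf n D U T (I j) j (K j)) ∧
      ∀ ψ : ℕ → ℕ → ℝ,
        ∑ j ∈ Finset.Icc 1 (n + 1),
          (if j ∈ U then -(ψ (I j) j + ψ j (K j) - ψ (I j) (K j))
            else ψ (I j) j + ψ j (K j) - ψ (I j) (K j)) =
        ∑ s ∈ Finset.range (n + 2), antisymm ψ (ρ s) (ρ (s + 1)) -
          antisymm ψ (ρ 0) (ρ (n + 2)) := by
  have he := isTriangulated_posEdge hUD hdisj hT hρ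
  have hex : ∀ t, ∃ i j k, t ∈ triangles (posEdge n D U T ρ) 0 (n + 2) →
      IsTriangleOf n D U T i j k ∧ t = sortedPos n D U i j k := fun t => by
    by_cases ht : t ∈ triangles (posEdge n D U T ρ) 0 (n + 2)
    · obtain ⟨i, j, k, h⟩ := exists_isTriangleOf_of_mem_triangles hUD hdisj hρ ht
      exact ⟨i, j, k, fun _ => h⟩
    · exact ⟨0, 0, 0, fun h => absurd h ht⟩
  choose I' J K' hIJK using hex
  have hmaps : Set.MapsTo J (triangles (posEdge n D U T ρ) 0 (n + 2))
      (Finset.Icc 1 (n + 1)) := fun t ht => by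
    obtain ⟨h1, h2, h3, -⟩ := (hIJK t ht).1
    simp only [Finset.coe_Icc, Set.mem_Icc]
    omega
  have hinj : Set.InjOn J (triangles (posEdge n D U T ρ) 0 (n + 2)) := fun t ht t' ht' h => by
    obtain ⟨h1, h2⟩ := hIJK t ht
    obtain ⟨h1', h2'⟩ := hIJK t' ht'
    rw [← h] at h1' h2'
    obtain ⟨h3, h4⟩ := h1.unique hUD hdisj hT h1'
    rw [h2, h2', h3, h4]
  have hsurj := Finset.surjOn_of_injOn_of_card_le J hmaps hinj (by
    have := he.card_triangles (by omega)
    rw [Nat.card_Icc]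
    omega)
  have hex' : ∀ j, ∃ i k, j ∈ Finset.Icc 1 (n + 1) → IsTriangleOf n D U T i j k := fun j => by
    by_cases hj : j ∈ Finset.Icc 1 (n + 1)
    · obtain ⟨t, ht, rfl⟩ := hsurj hj
      exact ⟨_, _, fun _ => (hIJK t ht).1⟩
    · exact ⟨0, 0, fun h => absurd h hj⟩
  choose I K hIK using hex'
  refine ⟨I, K, hIK, fun ψ => ?_⟩
  rw [Finset.range_eq_Ico]
  rw [← he.sum_triangles (fun p q => antisymm ψ (ρ p) (ρ q)) (by omega) le_rfl he.closing]
  symm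
  refine Finset.sum_nbij J hmaps hinj hsurj fun t ht => ?_
  obtain ⟨h1, h2⟩ := hIJK t ht
  obtain ⟨h3, h4⟩ := h1.unique hUD hdisj hT (hIK (J t) (hmaps ht))
  rw [← h3, ← h4, h2]
  obtain ⟨hij, hjk, hk, -⟩ := h1
  have hρpos : ∀ v ≤ n + 2, ρ (pos n D U v) = v := fun v hv => by
    have := hρ (pos n D U v) (by have := pos_lt hUD hdisj hv; omega)
    exact pos_injOn hUD hdisj this.1 hv this.2
  rw [← h2]
  have hi := hρpos (I' t) (by omega)
  have hj := hρpos (J t) (by omega)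
  have hk := hρpos (K' t) (by omega)
  generalize I' t = i at *
  generalize J t = j at *
  generalize K' t = k at *
  subst h2
  unfold sortedPos
  have hik := hij.trans hjk
  split_ifs <;> simp only [hi, hj, hk, antisymm_of_lt ψ hij, antisymm_of_lt ψ hjk,
    antisymm_of_lt ψ hik, antisymm_of_gt ψ hij, antisymm_of_gt ψ hjk, antisymm_of_gt ψ hik] <;> ring

/-! ### The sets `Bel` of the sides of a triangle -/

lemma Bel_subset (n : ℕ) (D U : Finset ℕ) (δ : ℕ × ℕ) : Bel n D U δ ⊆ Finset.Icc 1 (n + 1) :=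
  Finset.filter_subset _ _

lemma card_Bel_inter_of_notMem {n : ℕ} {D U : Finset ℕ} (hUD : D ∪ U = Finset.Icc 1 (n + 1))
    (hdisj : Disjoint D U) {i j k : ℕ} (hij : i < j) (hjk : j < k) (hk : k ≤ n + 2) (hj : j ∉ U)
    (B : Finset ℕ) :
    (Bel n D U (i, k) ∩ B).card =
      (Bel n D U (i, j) ∩ B).card + (Bel n D U (j, k) ∩ B).card + if j ∈ B then 1 else 0 := by
  have h1 : Bel n D U (i, k) = (Bel n D U (i, j) ∪ Bel n D U (j, k)) ∪ {j} := by
    ext v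
    rw [Finset.mem_union, Finset.mem_union, mem_Bel hUD hdisj (hij.trans hjk) hk,
      mem_Bel hUD hdisj hij (by omega), mem_Bel hUD hdisj hjk hk, Finset.mem_singleton]
    rcases lt_trichotomy v j with h | rfl | h
    · by_cases hv : v ∈ U <;> by_cases hi : i ∈ U <;> by_cases hk : k ∈ U <;>
        simp only [hv, hi, hj, hk, not_true_eq_false, not_false_eq_true, true_and, false_and,
          or_false, false_or, true_or, and_true, and_false, false_iff] <;> omega
    · simp only [hj, not_false_eq_true, true_and, false_and, or_false, lt_self_iff_false,
        and_false, or_true, iff_true]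
      exact ⟨by omega, Or.inr hij, Or.inr hjk⟩
    · by_cases hv : v ∈ U <;> by_cases hi : i ∈ U <;> by_cases hk : k ∈ U <;>
        simp only [hv, hi, hj, hk, not_true_eq_false, not_false_eq_true, true_and, false_and,
          or_false, false_or, true_or, and_true, and_false, false_iff] <;> omega
  have h2 : Disjoint (Bel n D U (i, j)) (Bel n D U (j, k)) := by
    rw [Finset.disjoint_left]
    intro v
    rw [mem_Bel hUD hdisj hij (by omega), mem_Bel hUD hdisj hjk hk]
    simp only [hj, false_and, or_false, false_or]
    rintro ⟨-, ⟨-, -, h3⟩ | ⟨hv, -, h3⟩⟩ ⟨-, ⟨hv', h4, -⟩ | ⟨hv', -, h4⟩⟩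
    · omega
    · omega
    · exact hv' hv
    · omega
  have h3 : Disjoint (Bel n D U (i, j) ∪ Bel n D U (j, k)) {j} := by
    rw [Finset.disjoint_singleton_right, Finset.mem_union, mem_Bel hUD hdisj hij (by omega),
      mem_Bel hUD hdisj hjk hk]
    simp [hj]
  rw [h1, Finset.union_inter_distrib_right, Finset.union_inter_distrib_right,
    Finset.card_union_of_disjoint, Finset.card_union_of_disjoint]
  · by_cases hB : j ∈ B <;> simp [hB]
  · exact h2.mono Finset.inter_subset_left Finset.inter_subset_left
  · rw [← Finset.union_inter_distrib_right]
    exact h3.mono Finset.inter_subset_left Finset.inter_subset_left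

lemma card_Bel_inter_of_mem {n : ℕ} {D U : Finset ℕ} (hUD : D ∪ U = Finset.Icc 1 (n + 1))
    (hdisj : Disjoint D U) {i j k : ℕ} (hij : i < j) (hjk : j < k) (hk : k ≤ n + 2) (hj : j ∈ U)
    (B : Finset ℕ) (hB : B ⊆ Finset.Icc 1 (n + 1)) :
    (Bel n D U (i, j) ∩ B).card + (Bel n D U (j, k) ∩ B).card =
      B.card + (Bel n D U (i, k) ∩ B).card + if j ∈ B then 1 else 0 := by
  have hj1 := mem_Icc_of_mem_U hUD hj
  have h1 : Bel n D U (i, j) ∪ Bel n D U (j, k) = Finset.Icc 1 (n + 1) := by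
    ext v
    rw [Finset.mem_union, mem_Bel hUD hdisj hij (by omega), mem_Bel hUD hdisj hjk hk,
      Finset.mem_Icc]
    by_cases hv : v ∈ U <;> simp only [hv, hj, not_true_eq_false, not_false_eq_true, true_and,
      false_and, or_false, false_or, true_or, and_true] <;> omega
  have h2 : Bel n D U (i, j) ∩ Bel n D U (j, k) = Bel n D U (i, k) ∪ {j} := by
    ext v
    rw [Finset.mem_inter, Finset.mem_union, mem_Bel hUD hdisj (hij.trans hjk) hk,
      mem_Bel hUD hdisj hij (by omega), mem_Bel hUD hdisj hjk hk, Finset.mem_singleton]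
    have hvj : v ∉ U → v ≠ j := by rintro h rfl; exact h hj
    by_cases hv : v ∈ U <;> by_cases hi : i ∈ U <;> by_cases hk : k ∈ U <;>
      simp only [hv, hi, hj, hk, not_true_eq_false, not_false_eq_true, true_and, false_and,
        or_false, false_or, true_or, and_true, and_false, forall_const] at hvj ⊢ <;> omega
  have h3 : Disjoint (Bel n D U (i, k)) {j} := by
    rw [Finset.disjoint_singleton_right, mem_Bel hUD hdisj (hij.trans hjk) hk]
    simp only [hj, not_true_eq_false, true_and, false_and, false_or]
    omega
  have h4 := Finset.card_union_add_card_inter (Bel n D U (i, j) ∩ B) (Bel n D U (j, k) ∩ B)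
  rw [← Finset.union_inter_distrib_right, ← Finset.inter_inter_distrib_right, h1, h2,
    Finset.inter_eq_right.2 hB, Finset.union_inter_distrib_right,
    Finset.card_union_of_disjoint (h3.mono Finset.inter_subset_left Finset.inter_subset_left)]
    at h4
  rw [← h4]
  by_cases hjB : j ∈ B <;> (simp [hjB]; try omega)

lemma Bel_subset_of_notMem {n : ℕ} {D U : Finset ℕ} (hUD : D ∪ U = Finset.Icc 1 (n + 1))
    (hdisj : Disjoint D U) {i j k : ℕ} (hij : i < j) (hjk : j < k) (hk : k ≤ n + 2)
    (hj : j ∉ U) :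
    Bel n D U (i, j) ⊆ Bel n D U (i, k) ∧ Bel n D U (j, k) ⊆ Bel n D U (i, k) := by
  constructor <;> intro v
  · rw [mem_Bel hUD hdisj (hij.trans hjk) hk, mem_Bel hUD hdisj hij (by omega)]
    simp only [hj, false_and, or_false, false_or]
    rintro ⟨h, ⟨hv, h1, h2⟩ | ⟨hv, h1⟩⟩
    · exact ⟨h, Or.inl ⟨hv, h1, Or.inr (by omega)⟩⟩
    · exact ⟨h, Or.inr ⟨hv, Or.inl h1⟩⟩
  · rw [mem_Bel hUD hdisj (hij.trans hjk) hk, mem_Bel hUD hdisj hjk hk]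
    simp only [hj, false_and, false_or]
    rintro ⟨h, ⟨hv, h1, h2⟩ | ⟨hv, h1⟩⟩
    · exact ⟨h, Or.inl ⟨hv, Or.inr (by omega), h2⟩⟩
    · exact ⟨h, Or.inr ⟨hv, Or.inr h1⟩⟩

lemma Bel_subset_of_mem {n : ℕ} {D U : Finset ℕ} (hUD : D ∪ U = Finset.Icc 1 (n + 1))
    (hdisj : Disjoint D U) {i j k : ℕ} (hij : i < j) (hjk : j < k) (hk : k ≤ n + 2)
    (hj : j ∈ U) :
    Bel n D U (i, k) ⊆ Bel n D U (i, j) ∧ Bel n D U (i, k) ⊆ Bel n D U (j, k) := by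
  constructor <;> intro v
  · rw [mem_Bel hUD hdisj (hij.trans hjk) hk, mem_Bel hUD hdisj hij (by omega)]
    rintro ⟨h, ⟨hv, h1, h2⟩ | ⟨hv, h1 | h1⟩⟩
    · exact ⟨h, Or.inl ⟨hv, h1, Or.inl hj⟩⟩
    · exact ⟨h, Or.inr ⟨hv, Or.inl h1⟩⟩
    · exact ⟨h, Or.inr ⟨hv, Or.inr ⟨hj, by omega⟩⟩⟩
  · rw [mem_Bel hUD hdisj (hij.trans hjk) hk, mem_Bel hUD hdisj hjk hk]
    rintro ⟨h, ⟨hv, h1, h2⟩ | ⟨hv, h1 | h1⟩⟩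
    · exact ⟨h, Or.inl ⟨hv, Or.inl hj, h2⟩⟩
    · exact ⟨h, Or.inr ⟨hv, Or.inl ⟨hj, by omega⟩⟩⟩
    · exact ⟨h, Or.inr ⟨hv, Or.inr h1⟩⟩

/-! ### Boundary edges -/

lemma mem_U_iff_pos {n : ℕ} {D U : Finset ℕ} (hUD : D ∪ U = Finset.Icc 1 (n + 1))
    (hdisj : Disjoint D U) {v : ℕ} (hv : v ≤ n + 2) : v ∈ U ↔ D.card + 2 ≤ pos n D U v := by
  constructor
  · intro h
    rw [pos_of_mem_U hUD hdisj h]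
    omega
  · intro h
    have hlast := pos_last n D U
    have : v < n + 2 := by
      rcases hv.lt_or_eq with h' | rfl
      · exact h'
      · omega
    exact mem_U_of_pos_gt hUD hdisj this le_rfl (by omega)

lemma eq_last_of_pos {n : ℕ} {D U : Finset ℕ} (hUD : D ∪ U = Finset.Icc 1 (n + 1))
    (hdisj : Disjoint D U) {v : ℕ} (hv : v ≤ n + 2) (h : pos n D U v = D.card + 1) :
    v = n + 2 :=
  pos_injOn hUD hdisj hv le_rfl (by rw [h, pos_last])

lemma Bel_lower_edge {n : ℕ} {D U : Finset ℕ} (hUD : D ∪ U = Finset.Icc 1 (n + 1))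
    (hdisj : Disjoint D U) {x y : ℕ} (hx : x ≤ n + 2) (hy : y ≤ n + 2)
    (hxy : pos n D U y = pos n D U x + 1) (h : pos n D U x ≤ D.card) :
    x < y ∧ Bel n D U (x, y) = ∅ := by
  have hxU : x ∉ U := by rw [mem_U_iff_pos hUD hdisj hx]; omega
  have hyU : y ∉ U := by rw [mem_U_iff_pos hUD hdisj hy]; omega
  have hlt : x < y := by
    rcases lt_trichotomy x y with h1 | rfl | h1
    · exact h1
    · omega
    · have := pos_lt_pos hUD hdisj h1 hx hyU
      omega
  refine ⟨hlt, Finset.eq_empty_of_forall_notMem fun v => ?_⟩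
  rw [mem_Bel hUD hdisj hlt hy]
  simp only [hxU, hyU, false_or, false_and, or_false, and_false]
  rintro ⟨-, hv, h1, h2⟩
  have := pos_lt_pos hUD hdisj h1 (by omega) hxU
  have := pos_lt_pos hUD hdisj h2 hy hv
  omega

lemma Bel_upper_edge {n : ℕ} {D U : Finset ℕ} (hUD : D ∪ U = Finset.Icc 1 (n + 1))
    (hdisj : Disjoint D U) {x y : ℕ} (hx : x ≤ n + 2) (hy : y ≤ n + 2)
    (hxy : pos n D U y = pos n D U x + 1) (h : D.card + 1 ≤ pos n D U x) :
    y < x ∧ Bel n D U (y, x) = Finset.Icc 1 (n + 1) := by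
  have hyU : y ∈ U := by rw [mem_U_iff_pos hUD hdisj hy]; omega
  have hy1 := mem_Icc_of_mem_U hUD hyU
  have hxU : x ∉ U → x = n + 2 := fun hxU => by
    rw [mem_U_iff_pos hUD hdisj hx] at hxU
    exact eq_last_of_pos hUD hdisj hx (by omega)
  have hlt : y < x := by
    rcases lt_trichotomy x y with h1 | rfl | h1
    · have := pos_gt_pos hUD hdisj h1 hy (by by_contra h2; have := hxU h2; omega)
      omega
    · omega
    · exact h1
  refine ⟨hlt, Finset.Subset.antisymm (Bel_subset _ _ _ _) fun v hv => ?_⟩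
  rw [Finset.mem_Icc] at hv
  rw [mem_Bel hUD hdisj hlt hx]
  refine ⟨hv, ?_⟩
  by_cases hvU : v ∈ U
  · refine Or.inr ⟨hvU, ?_⟩
    rcases le_or_gt v y with h1 | h1
    · exact Or.inl ⟨hyU, h1⟩
    · have h2 := pos_gt_pos hUD hdisj h1 (by omega) hyU
      rcases lt_or_ge v x with h3 | h3
      · have := pos_gt_pos hUD hdisj h3 hx hvU
        omega
      · exact Or.inr ⟨by by_contra h4; have := hxU h4; omega, h3⟩
  · refine Or.inl ⟨hvU, Or.inl hyU, ?_⟩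
    by_cases h1 : x ∈ U
    · exact Or.inl h1
    · exact Or.inr (by have := hxU h1; omega)

lemma Bel_closing_edge {n : ℕ} {D U : Finset ℕ} (hUD : D ∪ U = Finset.Icc 1 (n + 1))
    (hdisj : Disjoint D U) {y : ℕ} (hy : y ≤ n + 2) (hpos : pos n D U y = n + 2) :
    0 < y ∧ Bel n D U (0, y) = Finset.Icc 1 (n + 1) := by
  have hlt : 0 < y := by
    rcases Nat.eq_zero_or_pos y with rfl | h
    · rw [pos_zero] at hpos; omega
    · exact h
  have hyU : y ∉ U → y = n + 2 := fun hyU => by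
    by_contra hne
    have h1 := pos_lt_pos hUD hdisj (show y < n + 2 by omega) le_rfl hyU
    have h2 := pos_lt hUD hdisj (show n + 2 ≤ n + 2 from le_rfl)
    omega
  refine ⟨hlt, Finset.Subset.antisymm (Bel_subset _ _ _ _) fun v hv => ?_⟩
  rw [Finset.mem_Icc] at hv
  rw [mem_Bel hUD hdisj hlt hy]
  refine ⟨hv, ?_⟩
  by_cases hvU : v ∈ U
  · have hv2 := pos_gt_pos hUD hdisj (show v < n + 2 by omega) le_rfl hvU
    have hvn := pos_lt hUD hdisj (show v ≤ n + 2 by omega)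
    refine Or.inr ⟨hvU, Or.inr ⟨?_, ?_⟩⟩
    · by_contra h
      rw [hyU h] at hpos
      omega
    · by_contra h
      have := pos_gt_pos hUD hdisj (show v < y by omega) hy hvU
      omega
  · refine Or.inl ⟨hvU, Or.inr (by omega), ?_⟩
    by_cases h1 : y ∈ U
    · exact Or.inl h1
    · exact Or.inr (by have := hyU h1; omega)

lemma sum_upper_positions {n : ℕ} {D U : Finset ℕ} (hUD : D ∪ U = Finset.Icc 1 (n + 1))
    (hdisj : Disjoint D U) {ρ : ℕ → ℕ}
    (hρ : ∀ p ≤ n + 2, ρ p ≤ n + 2 ∧ pos n D U (ρ p) = p) (g : ℕ → ℝ) :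
    ∑ s ∈ Finset.Ico (D.card + 2) (n + 3), g (ρ s) = ∑ u ∈ U, g u := by
  refine Finset.sum_nbij ρ (fun s hs => ?_) (fun s hs s' hs' h => ?_) (fun u hu => ?_)
    fun _ _ => rfl
  · rw [Finset.mem_Ico] at hs
    have := hρ s (by omega)
    rw [mem_U_iff_pos hUD hdisj this.1]
    omega
  · simp only [Finset.coe_Ico, Set.mem_Ico] at hs hs'
    have h1 := (hρ s (by omega)).2
    rw [h, (hρ s' (by omega)).2] at h1
    exact h1.symm
  · have hu1 := mem_Icc_of_mem_U hUD hu
    have h1 := pos_lt hUD hdisj (show u ≤ n + 2 by omega)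
    refine ⟨pos n D U u, ?_, ?_⟩
    · simp only [Finset.coe_Ico, Set.mem_Ico]
      exact ⟨(mem_U_iff_pos hUD hdisj (by omega)).1 hu, h1⟩
    · have := hρ (pos n D U u) (by omega)
      exact pos_injOn hUD hdisj this.1 (by omega) this.2

lemma sum_boundary {n : ℕ} {D U : Finset ℕ} (hUD : D ∪ U = Finset.Icc 1 (n + 1))
    (hdisj : Disjoint D U) {ρ : ℕ → ℕ}
    (hρ : ∀ p ≤ n + 2, ρ p ≤ n + 2 ∧ pos n D U (ρ p) = p) (χ : ℕ → ℕ → ℝ) {φ : Finset ℕ → ℝ}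
    (hφ : φ ∅ = 0) :
    ∑ s ∈ Finset.range (n + 2),
        antisymm (fun x y => χ x y * φ (Bel n D U (x, y))) (ρ s) (ρ (s + 1)) -
      antisymm (fun x y => χ x y * φ (Bel n D U (x, y))) (ρ 0) (ρ (n + 2)) =
    -(∑ s ∈ Finset.Ico (D.card + 1) (n + 2), χ (ρ (s + 1)) (ρ s) + χ 0 (ρ (n + 2))) *
      φ (Finset.Icc 1 (n + 1)) := by
  have hcard := card_D_add_card_U hUD hdisj
  have h0 : ρ 0 = 0 := by
    have := hρ 0 (by omega)
    exact pos_injOn hUD hdisj this.1 (by omega) (by rw [this.2, pos_zero])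
  have hl := hρ (n + 2) le_rfl
  obtain ⟨h1, h2⟩ := Bel_closing_edge hUD hdisj hl.1 hl.2
  rw [h0, antisymm_of_lt _ h1, h2, Finset.range_eq_Ico,
    ← Finset.sum_Ico_consecutive _ (Nat.zero_le (D.card + 1)) (by omega),
    Finset.sum_eq_zero (s := Finset.Ico 0 (D.card + 1)), Finset.sum_congr rfl
      (g := fun s => -(χ (ρ (s + 1)) (ρ s) * φ (Finset.Icc 1 (n + 1)))),
    Finset.sum_neg_distrib, ← Finset.sum_mul]
  · ring
  · intro s hs
    rw [Finset.mem_Ico] at hs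
    have hs1 := hρ s (by omega)
    have hs2 := hρ (s + 1) (by omega)
    obtain ⟨h3, h4⟩ := Bel_upper_edge hUD hdisj hs1.1 hs2.1 (by omega) (by omega)
    rw [antisymm_of_gt _ h3, h4]
  · intro s hs
    rw [Finset.mem_Ico] at hs
    have hs1 := hρ s (by omega)
    have hs2 := hρ (s + 1) (by omega)
    obtain ⟨h3, h4⟩ := Bel_lower_edge hUD hdisj hs1.1 hs2.1 (by omega) (by omega)
    rw [antisymm_of_lt _ h3, h4, hφ, mul_zero]

/-! ### Weights of labels -/

/-- The weight at label `j`, with triangle `{I j, j, K j}`, of a function `φ` on sets of labels. -/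
def weight (n : ℕ) (D U : Finset ℕ) (I K : ℕ → ℕ) (φ : Finset ℕ → ℝ) (j : ℕ) : ℝ :=
  if j ∈ U then
    φ (Bel n D U (I j, j)) + φ (Bel n D U (j, K j)) - φ (Bel n D U (I j, K j)) -
      φ (Finset.Icc 1 (n + 1))
  else φ (Bel n D U (I j, K j)) - φ (Bel n D U (I j, j)) - φ (Bel n D U (j, K j))

/-- The signed coboundary of `χ · φ` over the triangle `{I j, j, K j}`. -/
def coboundary (n : ℕ) (D U : Finset ℕ) (I K : ℕ → ℕ) (χ : ℕ → ℕ → ℝ) (φ : Finset ℕ → ℝ)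
    (j : ℕ) : ℝ :=
  if j ∈ U then
    χ (I j) j * φ (Bel n D U (I j, j)) + χ j (K j) * φ (Bel n D U (j, K j)) -
      χ (I j) (K j) * φ (Bel n D U (I j, K j))
  else
    -(χ (I j) j * φ (Bel n D U (I j, j)) + χ j (K j) * φ (Bel n D U (j, K j)) -
      χ (I j) (K j) * φ (Bel n D U (I j, K j)))

lemma weight_sub (n : ℕ) (D U : Finset ℕ) (I K : ℕ → ℕ) (φ φ' : Finset ℕ → ℝ) (j : ℕ) :
    weight n D U I K (fun S => φ S - φ' S) j =
      weight n D U I K φ j - weight n D U I K φ' j := by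
  unfold weight
  split_ifs <;> ring

lemma sum_Icc_ite_mem {n : ℕ} {D U : Finset ℕ} (hUD : D ∪ U = Finset.Icc 1 (n + 1))
    (g : ℕ → ℝ) :
    ∑ j ∈ Finset.Icc 1 (n + 1), (if j ∈ U then g j else 0) = ∑ u ∈ U, g u := by
  rw [← Finset.sum_filter, Finset.filter_mem_eq_inter,
    Finset.inter_eq_right.2 (hUD ▸ Finset.subset_union_right)]

/-- The three instances of the boundary formula that are needed, with all triangles indexed by
their middle vertices. -/
lemma exists_triangles_sum_coboundary {n : ℕ} {D U : Finset ℕ}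
    (hUD : D ∪ U = Finset.Icc 1 (n + 1)) (hdisj : Disjoint D U) {T : Finset (ℕ × ℕ)}
    (hT : IsTriangulation n D U T) :
    ∃ I K : ℕ → ℕ, (∀ j ∈ Finset.Icc 1 (n + 1), IsTriangleOf n D U T (I j) j (K j)) ∧
      ∀ φ : Finset ℕ → ℝ, φ ∅ = 0 →
        (∑ j ∈ Finset.Icc 1 (n + 1), coboundary n D U I K (fun _ _ => 1) φ j =
          (U.card + 1) * φ (Finset.Icc 1 (n + 1))) ∧
        (∀ a ≤ n + 1,
          ∑ j ∈ Finset.Icc 1 (n + 1), coboundary n D U I K (fun _ y => if y ≤ a then 1 else 0) φ j =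
            (∑ u ∈ U, if u ≤ a then 1 else 0) * φ (Finset.Icc 1 (n + 1))) ∧
        (∀ b ≥ 1,
          ∑ j ∈ Finset.Icc 1 (n + 1), coboundary n D U I K (fun x _ => if b ≤ x then 1 else 0) φ j =
            (∑ u ∈ U, if b ≤ u then 1 else 0) * φ (Finset.Icc 1 (n + 1))) := by
  obtain ⟨ρ, hρ⟩ := exists_label hUD hdisj
  obtain ⟨I, K, hIK, hsum⟩ := exists_triangles_sum_eq hUD hdisj hT hρ
  have hcard := card_D_add_card_U hUD hdisj
  have key : ∀ (χ : ℕ → ℕ → ℝ) (φ : Finset ℕ → ℝ), φ ∅ = 0 →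
      ∑ j ∈ Finset.Icc 1 (n + 1), coboundary n D U I K χ φ j =
        (∑ s ∈ Finset.Ico (D.card + 1) (n + 2), χ (ρ (s + 1)) (ρ s) + χ 0 (ρ (n + 2))) *
          φ (Finset.Icc 1 (n + 1)) := fun χ φ hφ => by
    have h := hsum fun x y => χ x y * φ (Bel n D U (x, y))
    rw [sum_boundary hUD hdisj hρ χ hφ, neg_mul, ← neg_eq_iff_eq_neg,
      ← Finset.sum_neg_distrib] at h
    rw [← h]
    refine Finset.sum_congr rfl fun j _ => ?_
    unfold coboundary
    split_ifs <;> ring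
  refine ⟨I, K, hIK, fun φ hφ => ⟨?_, fun a ha => ?_, fun b hb => ?_⟩⟩
  · rw [key _ _ hφ, Finset.sum_const, Nat.card_Ico, show n + 2 - (D.card + 1) = U.card by omega,
      nsmul_eq_mul, mul_one]
  · rw [key _ _ hφ, ← sum_upper_positions hUD hdisj hρ,
      ← Finset.sum_Ico_succ_top (f := fun s => if ρ s ≤ a then (1 : ℝ) else 0) (by omega),
      Finset.sum_eq_sum_Ico_succ_bot (by omega), if_neg, zero_add]
    have h1 := hρ (D.card + 1) (by omega)
    rw [eq_last_of_pos hUD hdisj h1.1 h1.2]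
    omega
  · rw [key _ _ hφ, ← sum_upper_positions hUD hdisj hρ, if_neg (by omega), add_zero,
      Finset.sum_Ico_add' (fun s => if b ≤ ρ s then (1 : ℝ) else 0)]

lemma weight_eq_coboundary (n : ℕ) (D U : Finset ℕ) (I K : ℕ → ℕ) (φ : Finset ℕ → ℝ) (j : ℕ) :
    weight n D U I K φ j = coboundary n D U I K (fun _ _ => 1) φ j -
      if j ∈ U then φ (Finset.Icc 1 (n + 1)) else 0 := by
  unfold weight coboundary
  split_ifs <;> ring

lemma coboundary_prefix_le {n : ℕ} {D U : Finset ℕ} (hUD : D ∪ U = Finset.Icc 1 (n + 1))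
    (hdisj : Disjoint D U) {I K : ℕ → ℕ} {φ : Finset ℕ → ℝ}
    (hφ : ∀ S S', S ⊆ S' → φ S ≤ φ S') {a j : ℕ} (hI : I j < j) (hK : j < K j)
    (hKn : K j ≤ n + 2) :
    coboundary n D U I K (fun _ y => if y ≤ a then 1 else 0) φ j ≤
      if j ≤ a then
        weight n D U I K φ j + if j ∈ U then φ (Finset.Icc 1 (n + 1)) else 0
      else 0 := by
  unfold weight coboundary
  by_cases hj : j ∈ U
  · have h := hφ _ _ (Bel_subset_of_mem hUD hdisj hI hK hKn hj).2
    simp only [if_pos hj]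
    split_ifs <;> first | omega | linarith
  · have h := hφ _ _ (Bel_subset_of_notMem hUD hdisj hI hK hKn hj).2
    simp only [if_neg hj]
    split_ifs <;> first | omega | linarith

lemma coboundary_suffix_le {n : ℕ} {D U : Finset ℕ} (hUD : D ∪ U = Finset.Icc 1 (n + 1))
    (hdisj : Disjoint D U) {I K : ℕ → ℕ} {φ : Finset ℕ → ℝ}
    (hφ : ∀ S S', S ⊆ S' → φ S ≤ φ S') {b j : ℕ} (hI : I j < j) (hK : j < K j)
    (hKn : K j ≤ n + 2) :
    coboundary n D U I K (fun x _ => if b ≤ x then 1 else 0) φ j ≤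
      if b ≤ j then
        weight n D U I K φ j + if j ∈ U then φ (Finset.Icc 1 (n + 1)) else 0
      else 0 := by
  unfold weight coboundary
  by_cases hj : j ∈ U
  · have h := hφ _ _ (Bel_subset_of_mem hUD hdisj hI hK hKn hj).1
    simp only [if_pos hj]
    split_ifs <;> first | omega | linarith
  · have h := hφ _ _ (Bel_subset_of_notMem hUD hdisj hI hK hKn hj).1
    simp only [if_neg hj]
    split_ifs <;> first | omega | linarith

lemma exists_triangles_sum_weight {n : ℕ} {D U : Finset ℕ}
    (hUD : D ∪ U = Finset.Icc 1 (n + 1)) (hdisj : Disjoint D U) {T : Finset (ℕ × ℕ)}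
    (hT : IsTriangulation n D U T) :
    ∃ I K : ℕ → ℕ, (∀ j ∈ Finset.Icc 1 (n + 1), IsTriangleOf n D U T (I j) j (K j)) ∧
      ∀ φ : Finset ℕ → ℝ, φ ∅ = 0 →
        (∑ j ∈ Finset.Icc 1 (n + 1), weight n D U I K φ j = φ (Finset.Icc 1 (n + 1))) ∧
        ((∀ S S', S ⊆ S' → φ S ≤ φ S') →
          (∀ a ≤ n + 1,
            0 ≤ ∑ j ∈ Finset.Icc 1 (n + 1) with j ≤ a, weight n D U I K φ j) ∧
          (∀ b ≥ 1,
            0 ≤ ∑ j ∈ Finset.Icc 1 (n + 1) with b ≤ j, weight n D U I K φ j)) := by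
  obtain ⟨I, K, hIK, hsum⟩ := exists_triangles_sum_coboundary hUD hdisj hT
  refine ⟨I, K, hIK, fun φ hφ => ?_⟩
  obtain ⟨h1, h2, h3⟩ := hsum φ hφ
  have hbound : ∀ (p : ℕ → Prop) [DecidablePred p] (χ : ℕ → ℕ → ℝ),
      (∀ j ∈ Finset.Icc 1 (n + 1), coboundary n D U I K χ φ j ≤
        if p j then weight n D U I K φ j + if j ∈ U then φ (Finset.Icc 1 (n + 1)) else 0 else 0) →
      ∑ j ∈ Finset.Icc 1 (n + 1), coboundary n D U I K χ φ j =
        (∑ u ∈ U, if p u then 1 else 0) * φ (Finset.Icc 1 (n + 1)) →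
      0 ≤ ∑ j ∈ Finset.Icc 1 (n + 1) with p j, weight n D U I K φ j := fun p _ χ hle heq => by
    have h4 := Finset.sum_le_sum hle
    rw [heq, Finset.sum_mul, ← sum_Icc_ite_mem hUD, ← sub_nonneg, ← Finset.sum_sub_distrib] at h4
    rw [Finset.sum_filter]
    refine h4.trans_eq (Finset.sum_congr rfl fun j _ => ?_)
    split_ifs <;> ring
  refine ⟨?_, fun hmono => ⟨fun a ha => hbound (· ≤ a) _ (fun j hj => ?_) (h2 a ha),
    fun b hb => hbound (b ≤ ·) _ (fun j hj => ?_) (h3 b hb)⟩⟩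
  · simp only [weight_eq_coboundary, Finset.sum_sub_distrib]
    rw [h1, sum_Icc_ite_mem hUD fun _ => φ (Finset.Icc 1 (n + 1)), Finset.sum_const, nsmul_eq_mul]
    ring
  · obtain ⟨hI, hK, hKn, -⟩ := hIK j hj
    exact coboundary_prefix_le hUD hdisj hmono hI hK hKn
  · obtain ⟨hI, hK, hKn, -⟩ := hIK j hj
    exact coboundary_suffix_le hUD hdisj hmono hI hK hKn

/-! ### Triangular numbers -/

/-- The triangular number of the size of `S ∩ B`. -/
def triangular (B S : Finset ℕ) : ℝ := ((S ∩ B).card : ℝ) * ((S ∩ B).card + 1) / 2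

lemma triangular_empty (B : Finset ℕ) : triangular B ∅ = 0 := by simp [triangular]

lemma weight_triangular_of_notMem {n : ℕ} {D U : Finset ℕ}
    (hUD : D ∪ U = Finset.Icc 1 (n + 1)) (hdisj : Disjoint D U) {I K : ℕ → ℕ} {j : ℕ}
    (hI : I j < j) (hK : j < K j) (hKn : K j ≤ n + 2) (hj : j ∉ U) (B : Finset ℕ) :
    weight n D U I K (triangular B) j =
      ((Bel n D U (I j, j) ∩ B).card + if j ∈ B then 1 else 0) *
        ((Bel n D U (j, K j) ∩ B).card + if j ∈ B then 1 else 0) := by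
  have h := card_Bel_inter_of_notMem hUD hdisj hI hK hKn hj B
  rw [weight, if_neg hj, triangular, triangular, triangular, h]
  push_cast
  split_ifs <;> ring

lemma weight_triangular_of_mem {n : ℕ} {D U : Finset ℕ}
    (hUD : D ∪ U = Finset.Icc 1 (n + 1)) (hdisj : Disjoint D U) {I K : ℕ → ℕ} {j : ℕ}
    (hI : I j < j) (hK : j < K j) (hKn : K j ≤ n + 2) (hj : j ∈ U) {B : Finset ℕ}
    (hB : B ⊆ Finset.Icc 1 (n + 1)) :
    weight n D U I K (triangular B) j =
      (if j ∈ B then (B.card : ℝ) + 1 else 0) -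
        (B.card + (if j ∈ B then 1 else 0) - (Bel n D U (I j, j) ∩ B).card) *
          (B.card + (if j ∈ B then 1 else 0) - (Bel n D U (j, K j) ∩ B).card) := by
  have h : (((Bel n D U (I j, j) ∩ B).card + (Bel n D U (j, K j) ∩ B).card : ℕ) : ℝ) = _ :=
    congrArg _ (card_Bel_inter_of_mem hUD hdisj hI hK hKn hj B hB)
  rw [weight, if_pos hj, triangular, triangular, triangular, triangular,
    Finset.inter_eq_right.2 hB]
  push_cast at h
  generalize ((Bel n D U (I j, j) ∩ B).card : ℝ) = c at *
  generalize ((Bel n D U (j, K j) ∩ B).card : ℝ) = d at *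
  generalize ((Bel n D U (I j, K j) ∩ B).card : ℝ) = e at *
  split_ifs at h ⊢
  · obtain rfl : e = c + d - B.card - 1 := by linarith
    ring
  · obtain rfl : e = c + d - B.card := by linarith
    ring

lemma triangular_sub_mono {A B : Finset ℕ} (hBA : B ⊆ A) {S S' : Finset ℕ} (h : S ⊆ S') :
    triangular A S - triangular B S ≤ triangular A S' - triangular B S' := by
  have key : ∀ R : Finset ℕ, triangular A R - triangular B R =
      ((R ∩ (A \ B)).card : ℝ) * (2 * (R ∩ B).card + (R ∩ (A \ B)).card + 1) / 2 := fun R => by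
    have h1 : (R ∩ A).card = (R ∩ B).card + (R ∩ (A \ B)).card := by
      rw [← Finset.card_union_of_disjoint, ← Finset.inter_union_distrib_left,
        Finset.union_sdiff_of_subset hBA]
      exact Finset.disjoint_sdiff.mono Finset.inter_subset_right Finset.inter_subset_right
    rw [triangular, triangular, h1]
    push_cast
    ring
  rw [key, key]
  gcongr

lemma xcoord_eq_weight {n : ℕ} {D U : Finset ℕ} (hUD : D ∪ U = Finset.Icc 1 (n + 1))
    (hdisj : Disjoint D U) {T : Finset (ℕ × ℕ)} (hT : IsTriangulation n D U T) {I K : ℕ → ℕ}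
    {j : ℕ} (hIK : IsTriangleOf n D U T (I j) j (K j)) :
    xcoord n D U T j = weight n D U I K (triangular (Finset.Icc 1 (n + 1))) j := by
  have h : ∃ p : ℕ × ℕ, IsTriangleOf n D U T p.1 j p.2 := ⟨(I j, K j), hIK⟩
  obtain ⟨h1, h2⟩ := h.choose_spec.unique hUD hdisj hT hIK
  obtain ⟨hI, hK, hKn, -⟩ := hIK
  have hmem : j ∈ Finset.Icc 1 (n + 1) := by rw [Finset.mem_Icc]; omega
  rw [xcoord, dif_pos h, h1, h2]
  by_cases hj : j ∈ U
  · rw [if_neg (Finset.disjoint_right.1 hdisj hj),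
      weight_triangular_of_mem hUD hdisj hI hK hKn hj subset_rfl]
    simp only [if_pos hmem, Finset.inter_eq_left.2 (Bel_subset _ _ _ _), Nat.card_Icc, bel]
    push_cast
    ring
  · have hjD : j ∈ D := by
      rw [← hUD, Finset.mem_union] at hmem
      exact hmem.resolve_right hj
    rw [if_pos hjD, weight_triangular_of_notMem hUD hdisj hI hK hKn hj]
    simp only [if_pos hmem, Finset.inter_eq_left.2 (Bel_subset _ _ _ _), bel]

lemma weight_triangular_nonpos {n : ℕ} {D U : Finset ℕ}
    (hUD : D ∪ U = Finset.Icc 1 (n + 1)) (hdisj : Disjoint D U) {I K : ℕ → ℕ} {j a b : ℕ}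
    (hI : I j < j) (hK : j < K j) (hKn : K j ≤ n + 2) (hab : a < b) (hb : b ≤ n + 2)
    (hj : j ∉ Bel n D U (a, b)) :
    weight n D U I K (triangular (Bel n D U (a, b))) j ≤ 0 := by
  by_cases hjU : j ∈ U
  · rw [weight_triangular_of_mem hUD hdisj hI hK hKn hjU (Bel_subset _ _ _ _)]
    simp only [if_neg hj, add_zero, zero_sub, Left.neg_nonpos_iff]
    refine mul_nonneg ?_ ?_ <;> rw [sub_nonneg, Nat.cast_le] <;>
      exact Finset.card_le_card Finset.inter_subset_right
  · rw [weight_triangular_of_notMem hUD hdisj hI hK hKn hjU]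
    simp only [if_neg hj, add_zero]
    have hdj : (a ∉ U ∧ j ≤ a) ∨ (b ∉ U ∧ b ≤ j) := by
      rw [mem_Bel hUD hdisj hab hb] at hj
      by_contra! hcon
      refine hj ⟨by omega, Or.inl ⟨hjU, ?_, ?_⟩⟩
      · exact or_iff_not_imp_left.2 hcon.1
      · exact or_iff_not_imp_left.2 hcon.2
    rcases hdj with ⟨haU, hja⟩ | ⟨hbU, hbj⟩
    · have : Bel n D U (I j, j) ∩ Bel n D U (a, b) = ∅ := by
        ext v
        rw [Finset.mem_inter, mem_Bel hUD hdisj hab hb, mem_Bel hUD hdisj hI (by omega)]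
        simp only [haU, hjU, false_or, false_and, or_false, Finset.notMem_empty, iff_false]
        rintro ⟨⟨-, ⟨h1, -, h2⟩ | ⟨h1, -, h2⟩⟩, -, ⟨h3, h4, -⟩ | ⟨h3, -, h4⟩⟩
        · omega
        · exact h1 h3
        · exact h3 h1
        · omega
      simp [this]
    · have : Bel n D U (j, K j) ∩ Bel n D U (a, b) = ∅ := by
        ext v
        rw [Finset.mem_inter, mem_Bel hUD hdisj hab hb, mem_Bel hUD hdisj hK hKn]
        simp only [hbU, hjU, false_or, false_and, or_false, Finset.notMem_empty, iff_false]
        rintro ⟨⟨-, ⟨h1, h2, -⟩ | ⟨h1, -, h2⟩⟩, -, ⟨h3, -, h4⟩ | ⟨h3, -, h4⟩⟩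
        · omega
        · exact h1 h3
        · exact h3 h1
        · omega
      simp [this]

lemma sum_Bel_nonneg {n : ℕ} {D U : Finset ℕ} (hUD : D ∪ U = Finset.Icc 1 (n + 1))
    (hdisj : Disjoint D U) {a b : ℕ} (hab : a < b) (hb : b ≤ n + 2) (w : ℕ → ℝ)
    (hprefix : 0 ≤ ∑ j ∈ Finset.Icc 1 (n + 1) with j ≤ a, w j)
    (hsuffix : 0 ≤ ∑ j ∈ Finset.Icc 1 (n + 1) with b ≤ j, w j)
    (hw : ∀ j ∈ Bel n D U (a, b), j ∉ U → 0 ≤ w j) : 0 ≤ ∑ j ∈ Bel n D U (a, b), w j := by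
  have hmem := fun v => mem_Bel hUD hdisj hab hb (v := v)
  rw [← Finset.sum_filter_add_sum_filter_not _ (· ≤ a),
    ← Finset.sum_filter_add_sum_filter_not {j ∈ Bel n D U (a, b) | ¬ j ≤ a} (b ≤ ·)]
  refine add_nonneg ?_ (add_nonneg ?_ ?_)
  · by_cases ha : a ∈ U
    · refine hprefix.trans_eq (Finset.sum_congr (Finset.ext fun v => ?_) fun _ _ => rfl)
      simp only [Finset.mem_filter, hmem, Finset.mem_Icc, ha, true_or, true_and]
      by_cases hv : v ∈ U <;> simp only [hv, not_true_eq_false, not_false_eq_true, true_and,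
        false_and, or_false, false_or] <;> omega
    · refine Finset.sum_nonneg fun v hv => ?_
      simp only [Finset.mem_filter, hmem, ha, false_or, false_and] at hv
      omega
  · by_cases hbU : b ∈ U
    · refine hsuffix.trans_eq (Finset.sum_congr (Finset.ext fun v => ?_) fun _ _ => rfl)
      simp only [Finset.mem_filter, hmem, Finset.mem_Icc, hbU, true_or, true_and, and_true]
      by_cases hv : v ∈ U <;> simp only [hv, not_true_eq_false, not_false_eq_true, true_and,
        false_and, or_false, false_or] <;> omega
    · refine Finset.sum_nonneg fun v hv => ?_
      simp only [Finset.mem_filter, hmem, hbU, false_or, false_and, or_false] at hv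
      omega
  · refine Finset.sum_nonneg fun v hv => ?_
    simp only [Finset.mem_filter] at hv
    obtain ⟨⟨hv1, hva⟩, hvb⟩ := hv
    refine hw v hv1 fun hvU => ?_
    rw [hmem] at hv1
    rcases hv1 with ⟨-, h | ⟨-, h | h⟩⟩
    · exact h.1 hvU
    · exact hva h.2
    · exact hvb h.2

/-- For every triangulation `T` of `P`, the sum of all coordinates of
`x(T)` is `(n+2)(n+1)/2`, and for every internal diagonal `δ` the sum of the
coordinates of `x(T)` indexed by `Bel(δ)` is at least `(bel(δ)+1)·bel(δ)/2`. -/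
theorem sum_xcoord_eq_and_bel_sum_ge (n : ℕ) (hn : 1 ≤ n) (D U : Finset ℕ)
    (hUD : D ∪ U = Finset.Icc 1 (n + 1)) (hdisj : Disjoint D U)
    (T : Finset (ℕ × ℕ)) (hT : IsTriangulation n D U T) :
    (∑ j ∈ Finset.Icc 1 (n + 1), xcoord n D U T j = ((n : ℝ) + 2) * ((n : ℝ) + 1) / 2) ∧
    (∀ δ : ℕ × ℕ, IsInternalDiag n D U δ →
      ((bel n D U δ : ℝ) + 1) * (bel n D U δ : ℝ) / 2 ≤ ∑ j ∈ Bel n D U δ, xcoord n D U T j) := by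
  obtain ⟨I, K, hIK, hsum⟩ := exists_triangles_sum_weight hUD hdisj hT
  have hx : ∀ j ∈ Finset.Icc 1 (n + 1), xcoord n D U T j =
      weight n D U I K (triangular (Finset.Icc 1 (n + 1))) j :=
    fun j hj => xcoord_eq_weight hUD hdisj hT (hIK j hj)
  refine ⟨?_, ?_⟩
  · rw [Finset.sum_congr rfl hx, (hsum _ (triangular_empty _)).1, triangular, Finset.inter_self,
      Nat.card_Icc]
    push_cast
    ring
  rintro ⟨a, b⟩ ⟨⟨hab, hb⟩, -⟩
  dsimp only at hab hb
  set B := Bel n D U (a, b) with hB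
  have hBsub : B ⊆ Finset.Icc 1 (n + 1) := Bel_subset _ _ _ _
  have hlow : triangular B B ≤ ∑ j ∈ B, weight n D U I K (triangular B) j := by
    have h1 := (hsum _ (triangular_empty B)).1
    have h2 : triangular B (Finset.Icc 1 (n + 1)) = triangular B B := by
      rw [triangular, triangular, Finset.inter_eq_right.2 hBsub, Finset.inter_self]
    rw [← h2, ← h1, ← Finset.sum_sdiff hBsub]
    refine add_le_of_nonpos_left (Finset.sum_nonpos fun j hj => ?_)
    rw [Finset.mem_sdiff] at hj
    obtain ⟨hI, hK, hKn, -⟩ := hIK j hj.1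
    exact weight_triangular_nonpos hUD hdisj hI hK hKn hab hb hj.2
  have hrest : 0 ≤ ∑ j ∈ B, weight n D U I K
      (fun S => triangular (Finset.Icc 1 (n + 1)) S - triangular B S) j := by
    obtain ⟨hpre, hsuf⟩ := (hsum
      (fun S => triangular (Finset.Icc 1 (n + 1)) S - triangular B S)
      (by rw [triangular_empty, triangular_empty, sub_self])).2
      fun _ _ h => triangular_sub_mono hBsub h
    refine sum_Bel_nonneg hUD hdisj hab hb _ (hpre a (by omega)) (hsuf b (by omega))
      fun j hj hjU => ?_
    obtain ⟨hI, hK, hKn, -⟩ := hIK j (hBsub hj)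
    rw [weight_sub, weight_triangular_of_notMem hUD hdisj hI hK hKn hjU,
      weight_triangular_of_notMem hUD hdisj hI hK hKn hjU, if_pos (hBsub hj), if_pos hj, sub_nonneg]
    gcongr
  simp only [weight_sub, Finset.sum_sub_distrib] at hrest
  rw [Finset.sum_congr rfl fun j hj => hx j (hBsub hj)]
  rw [triangular, Finset.inter_self] at hlow
  unfold bel
  rw [← hB]
  linarith

end Spines
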